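/- arXiv:2308.13457 — 3 statements merged into one kernel-verified Lean document; each statement's English description precedes it below -/
import Mathlib

section
/- For all nonnegative integers r and n, the Lucas analogue of the generalized FiboCatalan number J_{r}·{2n}!/({n}!·{n+r+1}!) with J_{r} = {2r+1}!/{r}! is a polynomial with nonnegative integer coefficients; that is, there exists a polynomial p in ℤ[s,t], all of whose coefficients are nonnegative, such that {2r+1}!·{2n}! = p·{r}!·{n}!·{n+r+1}!. -/
open MvPolynomial

/-- The Lucas polynomials in `ℤ[s,t]` (with `s = X 0`, `t = X 1`):
`{0} = 0`, `{1} = 1`, `{n} = s{n−1} + t{n−2}` for `n ≥ 2`. -/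
noncomputable def lucas : ℕ → MvPolynomial (Fin 2) ℤ
  | 0 => 0
  | 1 => 1
  | n + 2 => X 0 * lucas (n + 1) + X 1 * lucas n

/-- The Lucas factorial `{n}! = {n}{n−1}⋯{2}{1}`, with `{0}! = 1`. -/
noncomputable def lucasFact : ℕ → MvPolynomial (Fin 2) ℤ
  | 0 => 1
  | n + 1 => lucas (n + 1) * lucasFact n

open Finset in
lemma U_eval_prod (n : ℕ) (x : ℝ) : (Polynomial.Chebyshev.U ℝ n).eval x =
    ∏ k ∈ Finset.range n, (2 * (x - Real.cos ((k + 1) * Real.pi / (n + 1)))) := by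
  have hinj : Set.InjOn (fun (k : ℕ) => Real.cos ((k + 1) * Real.pi / (n + 1)))
      (Finset.range n : Finset ℕ) :=
    (Finset.range n).nodup_map_iff_injOn.mp (Polynomial.Chebyshev.roots_U_real_nodup n)
  have hcard : Multiset.card (Polynomial.Chebyshev.U ℝ n).roots
      = (Polynomial.Chebyshev.U ℝ n).natDegree := by
    rw [Polynomial.Chebyshev.roots_U_real, Polynomial.Chebyshev.natDegree_U_natCast,
      Finset.card_val, Finset.card_image_of_injOn hinj, Finset.card_range]
  have h := Polynomial.C_leadingCoeff_mul_prod_multiset_X_sub_C hcard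
  rw [← h, Polynomial.Chebyshev.roots_U_real, Polynomial.Chebyshev.leadingCoeff_U_natCast,
    Finset.prod_map_val, Finset.prod_image hinj, Finset.prod_mul_distrib]
  simp [Polynomial.eval_prod]

lemma lucas_eval_U (w : ℝ) (hw : 0 < w) (s : ℝ) (n : ℕ) :
    eval ![s, -w ^ 2] (map (Int.castRingHom ℝ) (lucas (n + 1)))
      = w ^ n * (Polynomial.Chebyshev.U ℝ n).eval (s / (2 * w)) := by
  induction n using Nat.twoStepInduction with
  | zero => simp [lucas]
  | one => simp [lucas]; field_simp
  | more n ih1 ih2 =>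
    rw [lucas]
    have h : (Polynomial.Chebyshev.U ℝ ((n + 2 : ℕ) : ℤ)) = _ := Polynomial.Chebyshev.U_add_two ℝ n
    rw [h]
    simp only [map_add, map_mul, map_X, eval_X]
    rw [ih1, ih2]
    simp
    field_simp
    ring

lemma lucas_eval_prod (w : ℝ) (hw : 0 < w) (s : ℝ) (n : ℕ) (hn : 0 < n) :
    eval ![s, -w ^ 2] (map (Int.castRingHom ℝ) (lucas n))
      = ∏ k ∈ Finset.Ico 1 n, (s - 2 * w * Real.cos (Real.pi * (k / n))) := by
  obtain ⟨n, rfl⟩ : ∃ m, n = m + 1 := ⟨n - 1, by omega⟩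
  rw [lucas_eval_U w hw, U_eval_prod, Finset.prod_Ico_eq_prod_range]
  have : w ^ n = ∏ k ∈ Finset.range n, w := by simp
  rw [this, ← Finset.prod_mul_distrib]
  refine Finset.prod_congr (by simp) fun k hk => ?_
  have : Real.pi * (((1 + k : ℕ) : ℝ) / ((n + 1 : ℕ) : ℝ)) = (k + 1) * Real.pi / (n + 1) := by
    push_cast; ring
  rw [this]
  field_simp

/-- The irreducible-ish factors. -/
noncomputable def lfac (q : ℚ) : MvPolynomial (Fin 2) ℝ :=
  if q = 1 / 2 then X 0 else X 0 ^ 2 + C (4 * Real.cos (Real.pi * q) ^ 2) * X 1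

lemma prod_pair (n : ℕ) (hn : 0 < n) (f g : ℕ → ℝ)
    (h1 : ∀ k, 2 * k = n → f k = g k) (h2 : ∀ k, 0 < k → 2 * k < n → f k * f (n - k) = g k) :
    ∏ k ∈ Finset.Ico 1 n, f k = ∏ k ∈ (Finset.Ico 1 n).filter (fun k => 2 * k ≤ n), g k := by
  rw [← Finset.prod_filter_mul_prod_filter_not (Finset.Ico 1 n) (fun k => 2 * k ≤ n) f,
    ← Finset.prod_filter_mul_prod_filter_not ((Finset.Ico 1 n).filter (fun k => 2 * k ≤ n))
      (fun k => 2 * k < n) f,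
    ← Finset.prod_filter_mul_prod_filter_not ((Finset.Ico 1 n).filter (fun k => 2 * k ≤ n))
      (fun k => 2 * k < n) g]
  have e1 : ∏ k ∈ (Finset.Ico 1 n).filter (fun k => ¬ 2 * k ≤ n), f k
      = ∏ k ∈ ((Finset.Ico 1 n).filter (fun k => 2 * k ≤ n)).filter (fun k => 2 * k < n),
        f (n - k) := by
    refine Finset.prod_nbij' (fun k => n - k) (fun k => n - k) ?_ ?_ ?_ ?_ ?_
    · intro k hk; simp at hk ⊢; omega
    · intro k hk; simp at hk ⊢; omega
    · intro k hk; simp at hk ⊢; omega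
    · intro k hk; simp at hk ⊢; omega
    · intro k hk; simp at hk ⊢; congr 1; omega
  rw [e1, mul_right_comm, ← Finset.prod_mul_distrib]
  congr 1
  · refine Finset.prod_congr rfl fun k hk => ?_
    simp at hk
    exact h2 k (by omega) (by omega)
  · refine Finset.prod_congr rfl fun k hk => ?_
    simp at hk
    exact h1 k (by omega)

lemma lucas_map (n : ℕ) (hn : 0 < n) : map (Int.castRingHom ℝ) (lucas n)
    = ∏ k ∈ (Finset.Ico 1 n).filter (fun k => 2 * k ≤ n), lfac ((k : ℚ) / n) := by
  refine funext_set ![Set.univ, Set.Iio 0] ?_ ?_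
  · intro i; fin_cases i
    · exact Set.infinite_univ
    · exact Set.Iio_infinite 0
  · intro x hx
    have hx1 : x 1 < 0 := by simpa using hx 1 (Set.mem_univ _)
    obtain ⟨w, hw, hwx⟩ : ∃ w : ℝ, 0 < w ∧ x 1 = - w ^ 2 :=
      ⟨Real.sqrt (- x 1), Real.sqrt_pos.2 (by linarith), by
        rw [Real.sq_sqrt (by linarith)]; ring⟩
    have hxe : x = ![x 0, - w ^ 2] := by
      ext i; fin_cases i <;> simp [hwx]
    generalize x 0 = s at hxe
    subst hxe
    rw [lucas_eval_prod w hw s n hn, eval_prod]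
    have hn' : (n : ℝ) ≠ 0 := by positivity
    have hnq : (n : ℚ) ≠ 0 := by positivity
    apply prod_pair n hn
    · intro k hk
      have e : ((k : ℚ) / n) = 1 / 2 := by
        rw [div_eq_div_iff hnq two_ne_zero]; exact_mod_cast (by omega)
      have e' : ((k : ℝ) / n) = 1 / 2 := by
        rw [div_eq_div_iff hn' two_ne_zero]; exact_mod_cast (by omega)
      rw [e, e', lfac, if_pos rfl, mul_one_div, Real.cos_pi_div_two]
      simp
    · intro k hk0 hk
      have e : ((k : ℚ) / n) ≠ 1 / 2 := by
        intro h
        rw [div_eq_div_iff hnq two_ne_zero] at h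
        have : k * 2 = 1 * n := by exact_mod_cast h
        omega
      have e2 : Real.pi * (((n - k : ℕ) : ℝ) / n) = Real.pi - Real.pi * (k / n) := by
        rw [Nat.cast_sub (by omega)]; field_simp
      rw [e2, Real.cos_pi_sub, lfac, if_neg e]
      simp
      ring

/-- Rationals in `(0,1/2]` with bounded denominators. -/
noncomputable def lQ (N : ℕ) : Finset ℚ :=
  ((Finset.range (N + 1) ×ˢ Finset.range (N + 1)).image
    (fun p : ℕ × ℕ => (p.1 : ℚ) / p.2)).filter (fun q => 0 < q ∧ q ≤ 1 / 2)

lemma lucas_map' (N n : ℕ) (hn : 0 < n) (hN : n ≤ N) : map (Int.castRingHom ℝ) (lucas n)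
    = ∏ q ∈ lQ N, if q.den ∣ n then lfac q else 1 := by
  rw [lucas_map n hn, ← Finset.prod_filter]
  have hnq : (0 : ℚ) < n := by positivity
  have : (lQ N).filter (fun q => q.den ∣ n)
      = ((Finset.Ico 1 n).filter (fun k => 2 * k ≤ n)).image (fun k : ℕ => (k : ℚ) / n) := by
    ext q
    simp only [lQ, Finset.mem_filter, Finset.mem_image, Finset.mem_product, Finset.mem_range,
      Finset.mem_Ico]
    constructor
    · rintro ⟨⟨-, h0, h1⟩, c, hc⟩
      have hnum : 0 < q.num := Rat.num_pos.2 h0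
      have hd : (0 : ℚ) < q.den := by exact_mod_cast q.den_pos
      have hq : q = (q.num.toNat * c : ℕ) / (n : ℚ) := by
        have h3 : ((q.num.toNat : ℕ) : ℚ) = q.num := by
          exact_mod_cast Int.toNat_of_nonneg hnum.le
        have h4 : (n : ℚ) = q.den * c := by exact_mod_cast hc
        have h5 : (c : ℚ) ≠ 0 := by
          rintro h; rw [h] at h4; simp at h4; omega
        push_cast
        rw [h3, h4, mul_div_mul_right _ _ h5, Rat.num_div_den]
      refine ⟨q.num.toNat * c, ?_, hq.symm⟩
      rw [hq, div_le_div_iff₀ hnq two_pos] at h1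
      rw [hq] at h0
      have h6 : (q.num.toNat * c) * 2 ≤ 1 * n := by exact_mod_cast h1
      have h7 : 0 < q.num.toNat * c := by
        rcases Nat.eq_zero_or_pos (q.num.toNat * c) with h | h
        · rw [h] at h0; simp at h0
        · exact h
      omega
    · rintro ⟨k, ⟨⟨hk1, hk2⟩, hk3⟩, rfl⟩
      have hkq : (0 : ℚ) < k := by exact_mod_cast hk1
      refine ⟨⟨⟨(k, n), by simp; omega, rfl⟩, by positivity, ?_⟩, ?_⟩
      · rw [div_le_div_iff₀ hnq two_pos]; exact_mod_cast (by omega)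
      · have := Rat.den_dvd k n
        rw [Rat.divInt_eq_div] at this
        simp only [Int.cast_natCast] at this
        exact Int.natCast_dvd_natCast.1 this
  rw [this, Finset.prod_image]
  intro a _ b _ h
  have h : (a : ℚ) / n = b / n := h
  rw [div_left_inj' hnq.ne'] at h
  exact_mod_cast h

lemma lucasFact_map (N n : ℕ) (hN : n ≤ N) : map (Int.castRingHom ℝ) (lucasFact n)
    = ∏ q ∈ lQ N, lfac q ^ (n / q.den) := by
  induction n with
  | zero => simp [lucasFact]
  | succ n ih =>
    rw [lucasFact, map_mul, ih (by omega), lucas_map' N (n + 1) (by omega) hN,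
      ← Finset.prod_mul_distrib]
    refine Finset.prod_congr rfl fun q _ => ?_
    rw [Nat.succ_div]
    split_ifs <;> simp [pow_succ, mul_comm]

/-- Nonnegative coefficients. -/
def NNC (p : MvPolynomial (Fin 2) ℝ) : Prop := ∀ d, 0 ≤ p.coeff d

lemma NNC.mul {p q : MvPolynomial (Fin 2) ℝ} (hp : NNC p) (hq : NNC q) : NNC (p * q) := by
  intro d
  rw [coeff_mul]
  exact Finset.sum_nonneg fun i _ => mul_nonneg (hp _) (hq _)

lemma NNC.one : NNC 1 := by
  intro d
  rw [coeff_one]; split_ifs <;> norm_num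

lemma NNC.X (i : Fin 2) : NNC (X i) := by
  intro d
  rw [coeff_X']; split_ifs <;> norm_num

lemma NNC.C {c : ℝ} (hc : 0 ≤ c) : NNC (C c) := by
  intro d
  rw [coeff_C]; split_ifs <;> simp [hc]

lemma NNC.pow {p : MvPolynomial (Fin 2) ℝ} (hp : NNC p) (n : ℕ) : NNC (p ^ n) := by
  induction n with
  | zero => simpa using NNC.one
  | succ n ih => rw [pow_succ]; exact ih.mul hp

lemma NNC.lfac (q : ℚ) : NNC (lfac q) := by
  unfold _root_.lfac
  split_ifs
  · exact NNC.X 0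
  · intro d
    rw [coeff_add]
    exact add_nonneg ((NNC.X 0).pow 2 d) (((NNC.C (by positivity)).mul (NNC.X 1)) d)

lemma NNC.prod {ι : Type} (s : Finset ι) (f : ι → MvPolynomial (Fin 2) ℝ)
    (h : ∀ i ∈ s, NNC (f i)) : NNC (∏ i ∈ s, f i) :=
  Finset.prod_induction f NNC (fun _ _ => NNC.mul) NNC.one h

lemma div_ineq (r n d : ℕ) (hd : 2 ≤ d) :
    r / d + n / d + (n + r + 1) / d ≤ (2 * r + 1) / d + 2 * n / d := by
  have hd0 : 0 < d := by omega
  obtain ⟨a, A, ha, rfl⟩ : ∃ a A, a < d ∧ r = a + d * A :=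
    ⟨r % d, r / d, Nat.mod_lt _ hd0, (Nat.mod_add_div r d).symm⟩
  obtain ⟨b, B, hb, rfl⟩ : ∃ b B, b < d ∧ n = b + d * B :=
    ⟨n % d, n / d, Nat.mod_lt _ hd0, (Nat.mod_add_div n d).symm⟩
  have e1 : b + d * B + (a + d * A) + 1 = (a + b + 1) + d * (A + B) := by ring
  have e2 : 2 * (a + d * A) + 1 = (2 * a + 1) + d * (2 * A) := by ring
  have e3 : 2 * (b + d * B) = 2 * b + d * (2 * B) := by ring
  rw [e1, e2, e3]
  simp only [Nat.add_mul_div_left _ _ hd0, Nat.div_eq_of_lt ha, Nat.div_eq_of_lt hb]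
  have key : (a + b + 1) / d ≤ (2 * a + 1) / d + 2 * b / d := by
    by_cases h : a + b + 1 < d
    · simp [Nat.div_eq_of_lt h]
    · have h1 : (a + b + 1) / d < 2 := by
        rw [Nat.div_lt_iff_lt_mul hd0]; omega
      by_cases h2 : d ≤ 2 * a + 1
      · have := Nat.div_pos h2 hd0
        linarith [Nat.zero_le (2 * b / d)]
      · have h3 : d ≤ 2 * b := by omega
        have := Nat.div_pos h3 hd0
        linarith [Nat.zero_le ((2 * a + 1) / d)]
  omega

lemma lQ_den (N : ℕ) (q : ℚ) (hq : q ∈ lQ N) : 2 ≤ q.den := by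
  simp only [lQ, Finset.mem_filter] at hq
  obtain ⟨-, h0, h1⟩ := hq
  by_contra h
  have hd : q.den = 1 := by have := q.den_pos; omega
  have hq : q = q.num := ((Rat.den_eq_one_iff q).1 hd).symm
  have hnum : 0 < q.num := Rat.num_pos.2 h0
  have : (1 : ℚ) ≤ q.num := by exact_mod_cast hnum
  linarith

lemma real_version (r n : ℕ) : ∃ p : MvPolynomial (Fin 2) ℝ, NNC p ∧
    map (Int.castRingHom ℝ) (lucasFact (2 * r + 1) * lucasFact (2 * n))
      = p * map (Int.castRingHom ℝ) (lucasFact r * lucasFact n * lucasFact (n + r + 1)) := by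
  refine ⟨∏ q ∈ lQ (2 * r + 1 + 2 * n), lfac q ^ (((2 * r + 1) / q.den + 2 * n / q.den)
    - (r / q.den + n / q.den + (n + r + 1) / q.den)),
    NNC.prod _ _ fun q _ => (NNC.lfac q).pow _, ?_⟩
  simp only [map_mul]
  rw [lucasFact_map (2 * r + 1 + 2 * n) (2 * r + 1) (by omega),
    lucasFact_map (2 * r + 1 + 2 * n) (2 * n) (by omega),
    lucasFact_map (2 * r + 1 + 2 * n) r (by omega),
    lucasFact_map (2 * r + 1 + 2 * n) n (by omega),
    lucasFact_map (2 * r + 1 + 2 * n) (n + r + 1) (by omega)]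
  simp only [← Finset.prod_mul_distrib, ← pow_add]
  refine Finset.prod_congr rfl fun q hq => ?_
  rw [Nat.sub_add_cancel (div_ineq r n q.den (lQ_den _ q hq))]

lemma lucas_monic (n : ℕ) : (finSuccEquiv ℤ 1 (lucas (n + 1))).Monic ∧
    (finSuccEquiv ℤ 1 (lucas (n + 1))).natDegree = n := by
  induction n using Nat.twoStepInduction with
  | zero => simp [lucas]
  | one =>
    have : lucas (1 + 1) = X 0 := by simp [lucas]
    rw [this, finSuccEquiv_X_zero]
    exact ⟨Polynomial.monic_X, Polynomial.natDegree_X⟩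
  | more n ih1 ih2 =>
    rw [lucas, map_add, map_mul, map_mul, finSuccEquiv_X_zero,
      show (1 : Fin 2) = Fin.succ 0 from rfl, finSuccEquiv_X_succ]
    have hm := Polynomial.monic_X.mul ih2.1
    have hdeg : (Polynomial.X * finSuccEquiv ℤ 1 (lucas (n + 1 + 1))).natDegree = n + 2 := by
      rw [Polynomial.natDegree_X_mul ih2.1.ne_zero, ih2.2]
    have hlt : (Polynomial.C (X 0) * finSuccEquiv ℤ 1 (lucas (n + 1))).degree
        < (Polynomial.X * finSuccEquiv ℤ 1 (lucas (n + 1 + 1))).degree := by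
      apply Polynomial.degree_lt_degree
      rw [hdeg]
      refine lt_of_le_of_lt (Polynomial.natDegree_C_mul_le _ _) ?_
      rw [ih1.2]; omega
    exact ⟨hm.add_of_left hlt, by rw [Polynomial.natDegree_add_eq_left_of_degree_lt hlt, hdeg]⟩

lemma lucasFact_monic (n : ℕ) : (finSuccEquiv ℤ 1 (lucasFact n)).Monic := by
  induction n with
  | zero => simp [lucasFact]
  | succ n ih => rw [lucasFact, map_mul]; exact (lucas_monic n).1.mul ih

lemma finSucc_map (p : MvPolynomial (Fin 2) ℤ) :
    finSuccEquiv ℝ 1 (map (Int.castRingHom ℝ) p)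
      = (finSuccEquiv ℤ 1 p).map (map (Int.castRingHom ℝ)) := by
  ext i m
  rw [finSuccEquiv_coeff_coeff, coeff_map, Polynomial.coeff_map, coeff_map,
    finSuccEquiv_coeff_coeff]

lemma dvd_descend (a b : MvPolynomial (Fin 2) ℤ) (ha : (finSuccEquiv ℤ 1 a).Monic)
    (h : map (Int.castRingHom ℝ) a ∣ map (Int.castRingHom ℝ) b) : a ∣ b := by
  have h1 := map_dvd (finSuccEquiv ℝ 1) h
  rw [finSucc_map, finSucc_map, Polynomial.map_dvd_map _
    (map_injective _ (RingHom.injective_int _)) ha] at h1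
  exact (map_dvd_iff (finSuccEquiv ℤ 1)).1 h1

/-- The Lucas analogue of the generalized FiboCatalan number
`J_{r}·{2n}!/({n}!·{n+r+1}!)` with `J_{r} = {2r+1}!/{r}!` is a polynomial with
nonnegative integer coefficients. -/
theorem lucas_generalizedFiboCatalan_poly (r n : ℕ) :
    ∃ p : MvPolynomial (Fin 2) ℤ, (∀ d, 0 ≤ p.coeff d) ∧
      lucasFact (2 * r + 1) * lucasFact (2 * n)
        = p * (lucasFact r * lucasFact n * lucasFact (n + r + 1)) := by
  obtain ⟨P, hP, he⟩ := real_version r n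
  have hmon : (finSuccEquiv ℤ 1 (lucasFact r * lucasFact n * lucasFact (n + r + 1))).Monic := by
    rw [map_mul, map_mul]
    exact ((lucasFact_monic _).mul (lucasFact_monic _)).mul (lucasFact_monic _)
  obtain ⟨p, hp⟩ := dvd_descend _ _ hmon (Dvd.intro_left _ he.symm)
  refine ⟨p, ?_, by rw [hp, mul_comm]⟩
  have hinj : Function.Injective (map (σ := Fin 2) (Int.castRingHom ℝ)) :=
    map_injective _ (RingHom.injective_int _)
  have hne : map (Int.castRingHom ℝ) (lucasFact r * lucasFact n * lucasFact (n + r + 1)) ≠ 0 := by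
    intro h0
    rw [← map_zero (map (σ := Fin 2) (Int.castRingHom ℝ))] at h0
    have := hinj h0
    rw [this] at hmon
    simp at hmon
  rw [hp, map_mul, mul_comm] at he
  have hPp := mul_right_cancel₀ hne he
  intro d
  have := hP d
  rw [← hPp, coeff_map] at this
  simpa using this
end

section
/- For every integer n ≥ 1, the quantity F_{2n+1}·F_{2n}!/(F_{n+2}!·F_n!) = (1/F_{n+2})·binom(2n+1,n)_F is an integer; that is, F_{n+2}·F_{n+1}!·F_n! divides F_{2n+1}!. -/
/-- The Fibonacci factorial `F_n! = F_n F_{n-1} ⋯ F_2 F_1`, with `F_0! = 1`. -/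
def fibFact : ℕ → ℕ
  | 0 => 1
  | n + 1 => Nat.fib (n + 1) * fibFact n

theorem fibFact_pos (n : ℕ) : 0 < fibFact n := by
  induction n with
  | zero => simp [fibFact]
  | succ k ih => exact Nat.mul_pos (Nat.fib_pos.2 (Nat.succ_pos k)) ih

theorem fibFact_mul_dvd (s : ℕ) : ∀ a b : ℕ, a + b = s → fibFact a * fibFact b ∣ fibFact s := by
  induction s with
  | zero =>
    intro a b h
    obtain ⟨rfl, rfl⟩ : a = 0 ∧ b = 0 := by omega
    simp [fibFact]
  | succ s ih =>
    intro a b h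
    rcases a with _ | a
    · obtain rfl : b = s + 1 := by omega
      simp [fibFact]
    rcases b with _ | b
    · obtain rfl : a = s := by omega
      simp [fibFact]
    have h1 := ih (a + 1) b (by omega)
    have h2 := ih a (b + 1) (by omega)
    have hf : Nat.fib (s + 1) = Nat.fib a * Nat.fib (b + 1)
        + Nat.fib (a + 1) * Nat.fib (b + 2) := by
      rw [← Nat.fib_add a (b + 1)]
      congr 1
      omega
    have e : fibFact (s + 1) = Nat.fib a * (Nat.fib (b + 1) * fibFact s)
        + Nat.fib (b + 2) * (Nat.fib (a + 1) * fibFact s) := by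
      rw [fibFact, hf]; ring
    rw [e]
    apply dvd_add
    · apply Dvd.dvd.mul_left
      have := mul_dvd_mul_left (Nat.fib (b + 1)) h1
      rwa [mul_left_comm, ← fibFact] at this
    · apply Dvd.dvd.mul_left
      have := mul_dvd_mul_left (Nat.fib (a + 1)) h2
      rwa [← mul_assoc, ← fibFact] at this

/-- For `n ≥ 1`, `F_{2n+1}·F_{2n}!/(F_{n+2}!·F_n!) = (1/F_{n+2})·binom(2n+1,n)_F` is an
integer: `F_{n+2}·F_{n+1}!·F_n!` divides `F_{2n+1}!`. -/
theorem fibonomial_div (n : ℕ) (hn : 1 ≤ n) :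
    Nat.fib (n + 2) * fibFact (n + 1) * fibFact n ∣ fibFact (2 * n + 1) := by
  obtain ⟨m, rfl⟩ : ∃ m, n = m + 1 := ⟨n - 1, by omega⟩
  obtain ⟨B, hB⟩ := fibFact_mul_dvd (2 * (m + 1) + 1) (m + 1 + 1) (m + 1) (by omega)
  obtain ⟨C, hC⟩ := fibFact_mul_dvd (2 * (m + 1) + 1) (m + 1 + 2) m (by omega)
  have key : Nat.fib (m + 1 + 2) * C = Nat.fib (m + 1) * B := by
    have hp : 0 < fibFact (m + 1 + 1) * fibFact m :=
      Nat.mul_pos (fibFact_pos _) (fibFact_pos _)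
    apply Nat.eq_of_mul_eq_mul_left hp
    have e1 : fibFact (m + 1 + 2) = Nat.fib (m + 1 + 2) * fibFact (m + 1 + 1) := rfl
    have e2 : fibFact (m + 1) = Nat.fib (m + 1) * fibFact m := rfl
    rw [e1] at hC
    rw [e2] at hB
    linarith
  have hco : Nat.Coprime (Nat.fib (m + 1 + 2)) (Nat.fib (m + 1)) := by
    have hg : Nat.gcd (m + 1 + 2) (m + 1) ∣ 2 := by
      have h1 := Nat.gcd_dvd_left (m + 1 + 2) (m + 1)
      have h2 := Nat.gcd_dvd_right (m + 1 + 2) (m + 1)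
      exact (Nat.dvd_add_right h2).1 h1
    rw [Nat.Coprime, ← Nat.fib_gcd]
    rcases (Nat.dvd_prime Nat.prime_two).1 hg with h | h <;> rw [h] <;> rfl
  obtain ⟨D, rfl⟩ := hco.dvd_of_dvd_mul_left (Dvd.intro C key)
  exact ⟨D, by rw [hB]; ring⟩
end

section
/- For every integer n ≥ 1, the quantity {2}·{2n+1}·{2n}!/({n+2}!·{n}!) = {2}·(1/{n+2})·lucanomial(2n+1,n) is a polynomial with nonnegative integer coefficients; that is, there exists a polynomial p in ℤ[s,t], all of whose coefficients are nonnegative, such that {2}·{2n+1}·{2n}! = p·{n+2}!·{n}!. -/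
open MvPolynomial

lemma lucas_succ_succ (n : ℕ) : lucas (n + 2) = X 0 * lucas (n + 1) + X 1 * lucas n := by
  rw [lucas]

lemma lucasFact_succ (n : ℕ) : lucasFact (n + 1) = lucas (n + 1) * lucasFact n := by
  rw [lucasFact]

lemma lucas_add (a b : ℕ) :
    lucas (a + b + 1) = lucas (b + 1) * lucas (a + 1) + X 1 * lucas b * lucas a := by
  induction a using Nat.twoStepInduction with
  | zero => simp [lucas]
  | one =>
    rw [show 1 + b + 1 = b + 2 by ring, lucas_succ_succ]
    simp [lucas]; ring
  | more a h1 h2 =>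
    rw [show a + 2 + b + 1 = (a + b + 1) + 2 by ring, lucas_succ_succ,
      show a + b + 1 + 1 = a + 1 + b + 1 by ring, h1, h2, show a + 2 + 1 = (a + 1) + 2 by ring,
      lucas_succ_succ (a + 1), show a + 1 + 1 = a + 2 by ring, lucas_succ_succ a]
    ring

/-- The lucanomial, with `lucaM a b` standing for `lucanomial(a+b, a)`. -/
noncomputable def lucaM : ℕ → ℕ → MvPolynomial (Fin 2) ℤ
  | 0, _ => 1
  | _ + 1, 0 => 1
  | a + 1, b + 1 => lucas (b + 2) * lucaM a (b + 1) + X 1 * lucas a * lucaM (a + 1) b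

lemma lucaM_spec (a b : ℕ) : lucaM a b * (lucasFact a * lucasFact b) = lucasFact (a + b) := by
  induction a generalizing b with
  | zero => simp [lucaM, lucasFact]
  | succ a iha =>
    induction b with
    | zero => simp [lucaM, lucasFact]
    | succ b ihb =>
      have h1 := iha (b + 1)
      rw [show a + 1 + (b + 1) = (a + (b + 1)) + 1 by ring, lucasFact_succ (a + (b + 1)),
        lucas_add a (b + 1), lucaM]
      rw [show a + 1 + b = a + (b + 1) by ring] at ihb
      rw [add_mul (lucas (b + 1 + 1) * lucas (a + 1))]
      nth_rewrite 1 [← h1]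
      rw [← ihb, lucasFact_succ a, lucasFact_succ b]
      ring

/-- Weights: `s` has weight 1, `t` has weight 2. -/
def lwt : Fin 2 → ℕ := ![1, 2]

lemma hX0 : IsWeightedHomogeneous lwt (X 0 : MvPolynomial (Fin 2) ℤ) 1 :=
  isWeightedHomogeneous_X ℤ lwt 0

lemma hX1 : IsWeightedHomogeneous lwt (X 1 : MvPolynomial (Fin 2) ℤ) 2 :=
  isWeightedHomogeneous_X ℤ lwt 1

lemma lucas_hom (n : ℕ) : IsWeightedHomogeneous lwt (lucas (n + 1)) n := by
  induction n using Nat.twoStepInduction with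
  | zero => simpa [lucas] using isWeightedHomogeneous_one ℤ lwt
  | one => simpa [lucas] using hX0
  | more n h1 h2 =>
    rw [show n + 2 + 1 = (n + 1) + 2 by ring, lucas_succ_succ]
    refine IsWeightedHomogeneous.add ?_ ?_
    · convert hX0.mul h2 using 1; ring
    · convert hX1.mul h1 using 1; ring

lemma lucaM_hom (a b : ℕ) : IsWeightedHomogeneous lwt (lucaM a b) (a * b) := by
  induction a generalizing b with
  | zero => simpa [lucaM] using isWeightedHomogeneous_one ℤ lwt
  | succ a iha =>
    induction b with
    | zero => simpa [lucaM] using isWeightedHomogeneous_one ℤ lwt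
    | succ b ihb =>
      rw [lucaM]
      refine IsWeightedHomogeneous.add ?_ ?_
      · convert (lucas_hom (b + 1)).mul (iha (b + 1)) using 1; ring
      · cases a with
        | zero => simpa [lucas] using isWeightedHomogeneous_zero ℤ lwt _
        | succ a => convert (hX1.mul (lucas_hom a)).mul ihb using 1; ring

/-- Specialisation `s ↦ x`, `t ↦ 1`. -/
noncomputable def lphi : MvPolynomial (Fin 2) ℤ →ₐ[ℤ] Polynomial ℝ :=
  aeval ![Polynomial.X, 1]

lemma lphi_coeff {p : MvPolynomial (Fin 2) ℤ} {k : ℕ} (hp : IsWeightedHomogeneous lwt p k)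
    (d : Fin 2 →₀ ℕ) (hd : p.coeff d ≠ 0) : (lphi p).coeff (d 0) = ((p.coeff d : ℤ) : ℝ) := by
  have hw : ∀ e : Fin 2 →₀ ℕ, p.coeff e ≠ 0 → e 0 + 2 * e 1 = k := by
    intro e he
    have := hp he
    rw [Finsupp.weight_apply, Finsupp.sum_fintype _ _ (by simp)] at this
    simp [lwt] at this
    omega
  have h1 : lphi p = ∑ e ∈ p.support, Polynomial.monomial (e 0) ((p.coeff e : ℤ) : ℝ) := by
    rw [lphi, aeval_def, eval₂_eq']
    refine Finset.sum_congr rfl fun e _ => ?_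
    simp [Fin.prod_univ_two, ← Polynomial.C_mul_X_pow_eq_monomial]
  rw [h1, Polynomial.finsetSum_coeff, Finset.sum_eq_single d]
  · simp
  · intro e he hne
    rw [Polynomial.coeff_monomial, if_neg]
    intro h
    apply hne
    have a1 := hw e (mem_support_iff.mp he)
    have a2 := hw d hd
    ext i
    fin_cases i
    · exact h
    · simp; omega
  · intro h
    exact absurd (mem_support_iff.mpr hd) h

lemma lphi_lucas_succ_succ (n : ℕ) :
    lphi (lucas (n + 2)) = Polynomial.X * lphi (lucas (n + 1)) + lphi (lucas n) := by
  rw [lucas_succ_succ]; simp [lphi]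

lemma lphi_lucas_monic (n : ℕ) :
    (lphi (lucas (n + 1))).Monic ∧ (lphi (lucas (n + 1))).natDegree = n ∧
      (lphi (lucas n)).degree < (n : ℕ) := by
  induction n with
  | zero => simp [lucas]
  | succ n ih =>
    obtain ⟨h1, h2, h3⟩ := ih
    have e1 : (lphi (lucas (n + 1))).degree = n := by
      rw [Polynomial.degree_eq_natDegree h1.ne_zero, h2]
    have e2 : (Polynomial.X * lphi (lucas (n + 1))).degree = ((n + 1 : ℕ) : WithBot ℕ) := by
      rw [Polynomial.degree_mul, e1, Polynomial.degree_X, add_comm]; rfl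
    have hlt : (lphi (lucas n)).degree < (Polynomial.X * lphi (lucas (n + 1))).degree := by
      rw [e2]; exact h3.trans (by exact_mod_cast Nat.lt_succ_self n)
    rw [show n + 1 + 1 = n + 2 by ring, lphi_lucas_succ_succ]
    refine ⟨(Polynomial.monic_X.mul h1).add_of_left hlt, ?_, ?_⟩
    · apply Polynomial.natDegree_eq_of_degree_eq_some
      rw [Polynomial.degree_add_eq_left_of_degree_lt hlt, e2]
    · rw [e1]; exact_mod_cast Nat.lt_succ_self n

lemma lphi_lucasFact_monic (n : ℕ) : (lphi (lucasFact n)).Monic := by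
  induction n with
  | zero => simp [lucasFact]
  | succ n ih => rw [lucasFact_succ, map_mul]; exact (lphi_lucas_monic n).1.mul ih

lemma lucas_root (z : ℂ) (hz : 0 < z.re) (n : ℕ) :
    Polynomial.aeval z (lphi (lucas (n + 1))) ≠ 0 ∧
    0 ≤ (Polynomial.aeval z (lphi (lucas (n + 1))) *
      (starRingEnd ℂ) (Polynomial.aeval z (lphi (lucas n)))).re := by
  induction n with
  | zero => simp [lucas]
  | succ n ih =>
    obtain ⟨h1, h2⟩ := ih
    have hrec : Polynomial.aeval z (lphi (lucas (n + 1 + 1))) =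
        z * Polynomial.aeval z (lphi (lucas (n + 1))) + Polynomial.aeval z (lphi (lucas n)) := by
      rw [show n + 1 + 1 = n + 2 by ring, lphi_lucas_succ_succ]; simp
    rw [hrec]
    generalize Polynomial.aeval z (lphi (lucas (n + 1))) = u at *
    generalize Polynomial.aeval z (lphi (lucas n)) = v at *
    have hu : 0 < Complex.normSq u := Complex.normSq_pos.mpr h1
    have key : 0 < ((z * u + v) * (starRingEnd ℂ) u).re := by
      have : ((z * u + v) * (starRingEnd ℂ) u).re
          = z.re * Complex.normSq u + (u * (starRingEnd ℂ) v).re := by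
        simp [Complex.normSq_apply]; ring
      rw [this]
      have := mul_pos hz hu
      linarith
    refine ⟨?_, key.le⟩
    intro h
    rw [h] at key
    simp at key

lemma lucasFact_root (z : ℂ) (hz : 0 < z.re) (n : ℕ) :
    Polynomial.aeval z (lphi (lucasFact n)) ≠ 0 := by
  induction n with
  | zero => simp [lucasFact]
  | succ n ih =>
    rw [lucasFact_succ, map_mul, map_mul]
    exact mul_ne_zero (lucas_root z hz n).1 ih

lemma coeff_mul_nonneg {f g : Polynomial ℝ} (hf : ∀ i, 0 ≤ f.coeff i) (hg : ∀ i, 0 ≤ g.coeff i)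
    (i : ℕ) : 0 ≤ (f * g).coeff i := by
  rw [Polynomial.coeff_mul]
  exact Finset.sum_nonneg fun x _ => mul_nonneg (hf _) (hg _)

lemma stable_nonneg (k : ℕ) : ∀ f : Polynomial ℝ, f.natDegree = k → f.Monic →
    (∀ z : ℂ, 0 < z.re → Polynomial.aeval z f ≠ 0) → ∀ i, 0 ≤ f.coeff i := by
  induction k using Nat.strong_induction_on with
  | _ k ih =>
    intro f hk hf hr
    rcases Nat.eq_zero_or_pos k with h0 | hpos
    · have : f = 1 := hf.natDegree_eq_zero.mp (hk.trans h0)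
      intro i
      rw [this, Polynomial.coeff_one]
      split_ifs <;> norm_num
    · have main : ∀ q : Polynomial ℝ, q.Monic → 0 < q.natDegree → (∀ i, 0 ≤ q.coeff i) → q ∣ f →
          ∀ i, 0 ≤ f.coeff i := by
        rintro q hq hqd hqc ⟨g, rfl⟩
        have hg : g.Monic := hq.of_mul_monic_left hf
        have hdeg := hq.natDegree_mul hg
        refine coeff_mul_nonneg hqc (ih g.natDegree (by omega) g rfl hg ?_)
        intro z hz h
        exact hr z hz (by rw [map_mul, h, mul_zero])
      obtain ⟨z, hz⟩ := IsAlgClosed.exists_aeval_eq_zero ℂ f (by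
        have := Polynomial.natDegree_pos_iff_degree_pos.mp (hk ▸ hpos)
        exact this.ne')
      have hre : z.re ≤ 0 := by
        by_contra h
        exact hr z (not_le.mp h) hz
      by_cases him : z.im = 0
      · have hzr : z = (z.re : ℂ) := by apply Complex.ext <;> simp [him]
        refine main (Polynomial.X - Polynomial.C z.re) (Polynomial.monic_X_sub_C _) (by simp) ?_ ?_
        · intro i
          rw [Polynomial.coeff_sub, Polynomial.coeff_X, Polynomial.coeff_C]
          split_ifs <;> linarith
        · rw [Polynomial.dvd_iff_isRoot, Polynomial.IsRoot]
          rw [hzr] at hz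
          have := Polynomial.aeval_algebraMap_apply ℂ z.re f
          simp only [Complex.coe_algebraMap] at this
          rw [hz] at this
          have h2 := Complex.ofReal_eq_zero.mp this.symm
          simpa using h2
      · have hq := Polynomial.quadratic_dvd_of_aeval_eq_zero_im_ne_zero f hz him
        have e : (Polynomial.X ^ 2 - Polynomial.C (2 * z.re) * Polynomial.X
            + Polynomial.C (‖z‖ ^ 2) : Polynomial ℝ) = Polynomial.C 1 * Polynomial.X ^ 2
              + Polynomial.C (-(2 * z.re)) * Polynomial.X + Polynomial.C (‖z‖ ^ 2) := by
          simp; ring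
        rw [e] at hq
        refine main _ ?_ ?_ ?_ hq
        · rw [Polynomial.Monic, Polynomial.leadingCoeff_quadratic one_ne_zero]
        · rw [Polynomial.natDegree_quadratic one_ne_zero]; norm_num
        · intro i
          simp only [Polynomial.coeff_add, Polynomial.coeff_C_mul, Polynomial.coeff_X_pow,
            Polynomial.coeff_X, Polynomial.coeff_C]
          have := sq_nonneg ‖z‖
          split_ifs <;> linarith

lemma lucas_key (m : ℕ) : lucas 2 * lucas (2 * (m + 1) + 1) =
    lucas (m + 3) * lucas (m + 2) - X 1 ^ 2 * (lucas (m + 1) * lucas m) := by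
  rw [show 2 * (m + 1) + 1 = (m + 1) + (m + 1) + 1 by ring, lucas_add,
    show m + 1 + 1 = m + 2 by ring, lucas_succ_succ (m + 1), show m + 1 + 1 = m + 2 by ring,
    lucas_succ_succ m, lucas_succ_succ 0]
  simp [lucas]; ring

lemma exists_quot (m : ℕ) : ∃ (p : MvPolynomial (Fin 2) ℤ) (k : ℕ),
    IsWeightedHomogeneous lwt p k ∧
      lucas 2 * lucas (2 * (m + 1) + 1) * lucasFact (2 * (m + 1))
        = p * (lucasFact (m + 1 + 2) * lucasFact (m + 1)) := by
  have h1 := lucaM_spec (m + 1) (m + 1)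
  rw [← two_mul] at h1
  have f3 : lucasFact (m + 1 + 2) = lucas (m + 3) * (lucas (m + 2) * lucasFact (m + 1)) := by
    rw [lucasFact_succ, lucasFact_succ]
  cases m with
  | zero =>
    refine ⟨_, _, lucaM_hom 1 1, ?_⟩
    rw [lucas_key, f3, ← h1]
    simp [lucas]; ring
  | succ j =>
    have h2 := lucaM_spec j (j + 1 + 1 + 2)
    rw [show j + (j + 1 + 1 + 2) = 2 * (j + 1 + 1) by ring] at h2
    refine ⟨lucaM (j + 1 + 1) (j + 1 + 1) - X 1 ^ 2 * lucaM j (j + 1 + 1 + 2), (j + 1 + 1) * (j + 1 + 1),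
      (lucaM_hom _ _).sub ?_, ?_⟩
    · have h3 := (hX1.pow 2).mul (lucaM_hom j (j + 1 + 1 + 2))
      rw [show 2 • 2 + j * (j + 1 + 1 + 2) = (j + 1 + 1) * (j + 1 + 1) by
        rw [smul_eq_mul]; ring] at h3
      exact h3
    · rw [lucas_key, sub_mul, sub_mul]
      nth_rewrite 1 [← h1]
      rw [← h2, f3, lucasFact_succ (j + 1), lucasFact_succ j]
      ring

/-- For `n ≥ 1`, `{2}·{2n+1}·{2n}!/({n+2}!·{n}!) = {2}·(1/{n+2})·lucanomial(2n+1,n)` is a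
polynomial with nonnegative integer coefficients. -/
theorem lucas_two_mul_lucanomial_poly (n : ℕ) (hn : 1 ≤ n) :
    ∃ p : MvPolynomial (Fin 2) ℤ, (∀ d, 0 ≤ p.coeff d) ∧
      lucas 2 * lucas (2 * n + 1) * lucasFact (2 * n)
        = p * (lucasFact (n + 2) * lucasFact n) := by
  obtain ⟨m, rfl⟩ : ∃ m, n = m + 1 := ⟨n - 1, by omega⟩
  obtain ⟨p, k, hp, he⟩ := exists_quot m
  refine ⟨p, fun d => ?_, he⟩
  by_cases hd : p.coeff d = 0
  · exact hd.ge
  have he' := congrArg lphi he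
  simp only [map_mul] at he'
  have hmon : (lphi p).Monic := by
    refine Polynomial.Monic.of_mul_monic_right
      ((lphi_lucasFact_monic (m + 1 + 2)).mul (lphi_lucasFact_monic (m + 1))) ?_
    rw [← he']
    exact ((lphi_lucas_monic 1).1.mul (lphi_lucas_monic _).1).mul (lphi_lucasFact_monic _)
  have hnn := stable_nonneg _ (lphi p) rfl hmon (by
    intro z hz h
    have h2 := congrArg (Polynomial.aeval z) he'
    simp only [map_mul] at h2
    rw [h, zero_mul] at h2
    exact mul_ne_zero (mul_ne_zero (lucas_root z hz 1).1 (lucas_root z hz _).1)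
      (lucasFact_root z hz _) h2) (d 0)
  rw [lphi_coeff hp d hd] at hnn
  exact_mod_cast hnn
end
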